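/- Upper bound for the angular weight of the high-frequency multiplier (Lemma 6.2, inequality (6.7)): for all constants C ≥ 1, c ∈ (0,1], η ∈ (0,1) there exists δ₀ > 0 depending only on C, c, η with the following property. For every δ ∈ (0, δ₀] and every s₂ > 0 there exist constants C″ ≥ 1 and R ≥ 1 (depending on δ, s₂, C, c, η) such that for every (C,c,η)-admissible α, every s ∈ (0, s₂], and every r > 0, with β_s(r) = s^{1/2} ∫₀^{δ s^{−1/2} r} α(y)/⟨y⟩ dy: 0 ≤ (β_s(r) coth(r) − ∂_r β_s(r))/sinh(r)² ≤ δ s^{−1} ∂_r β_s(r) + C″ · 1_{(0,R]}(r). -/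

import Mathlib

open MeasureTheory Set

/-- The Japanese bracket `⟨y⟩ = (1+y²)^{1/2}`. -/
noncomputable def jap (y : ℝ) : ℝ := Real.sqrt (1 + y ^ 2)

/-- The hyperbolic cotangent. -/
noncomputable def cothR (r : ℝ) : ℝ := Real.cosh r / Real.sinh r

/-- The high-frequency multiplier weight
`β_s(r) = s^{1/2} ∫₀^{δ s^{−1/2} r} α(y)/⟨y⟩ dy`. -/
noncomputable def betaHigh (α : ℝ → ℝ) (δ s r : ℝ) : ℝ :=
  Real.sqrt s * ∫ y in (0 : ℝ)..(δ * r / Real.sqrt s), α y / jap y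

/-- A `(C,c,η)`-admissible weight: a smooth function `α : [0,∞) → (0,∞)` such that
`α′(y) = 0` for `0 ≤ y ≤ 1`; `|α^{(j)}(y)| ≤ C α(y)/⟨y⟩^j` for `j = 1,2,3` and all
`y ≥ 0`; `|α′(y)| ≤ C η α(y)/y` and `|α″(y)| ≤ C η α(y)/y²` for `y ≥ 1`;
`α(y) ≥ c ⟨y⟩^{−η}` for all `y ≥ 0`; `y ↦ α(y)/⟨y⟩` is nonincreasing; and
`∫₀^∞ α(y)/⟨y⟩ dy ≤ C`. -/
structure IsAdmissible (C c η : ℝ) (α : ℝ → ℝ) : Prop where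
  smooth : ContDiffOn ℝ (⊤ : ℕ∞) α (Ici (0 : ℝ))
  pos : ∀ y ∈ Ici (0 : ℝ), 0 < α y
  deriv_eq_zero : ∀ y ∈ Icc (0 : ℝ) 1, derivWithin α (Ici 0) y = 0
  deriv1_le : ∀ y ∈ Ici (0 : ℝ), |derivWithin α (Ici 0) y| ≤ C * α y / jap y
  deriv2_le : ∀ y ∈ Ici (0 : ℝ),
    |derivWithin (derivWithin α (Ici 0)) (Ici 0) y| ≤ C * α y / jap y ^ 2
  deriv3_le : ∀ y ∈ Ici (0 : ℝ),
    |derivWithin (derivWithin (derivWithin α (Ici 0)) (Ici 0)) (Ici 0) y|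
      ≤ C * α y / jap y ^ 3
  deriv1_le' : ∀ y ≥ (1 : ℝ), |derivWithin α (Ici 0) y| ≤ C * η * α y / y
  deriv2_le' : ∀ y ≥ (1 : ℝ),
    |derivWithin (derivWithin α (Ici 0)) (Ici 0) y| ≤ C * η * α y / y ^ 2
  lower : ∀ y ∈ Ici (0 : ℝ), c * jap y ^ (-η) ≤ α y
  antitone : AntitoneOn (fun y => α y / jap y) (Ici (0 : ℝ))
  integrable : IntegrableOn (fun y => α y / jap y) (Ioi (0 : ℝ))
  integral_le : (∫ y in Ioi (0 : ℝ), α y / jap y) ≤ C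

lemma one_le_jap (y : ℝ) : 1 ≤ jap y :=
  Real.one_le_sqrt.2 (by nlinarith [sq_nonneg y])

lemma jap_pos (y : ℝ) : 0 < jap y := one_pos.trans_le (one_le_jap y)

lemma jap_sq (y : ℝ) : jap y ^ 2 = 1 + y ^ 2 := Real.sq_sqrt (by positivity)

lemma continuous_jap : Continuous jap := by unfold jap; fun_prop

namespace IsAdmissible

variable {C c η : ℝ} {α : ℝ → ℝ}

lemma quot_pos (h : IsAdmissible C c η α) {y : ℝ} (hy : 0 ≤ y) : 0 < α y / jap y :=
  div_pos (h.pos y hy) (jap_pos y)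

lemma continuousOn_quot (h : IsAdmissible C c η α) :
    ContinuousOn (fun y => α y / jap y) (Ici 0) :=
  h.smooth.continuousOn.div continuous_jap.continuousOn fun y _ => (jap_pos y).ne'

lemma intervalIntegrable_quot (h : IsAdmissible C c η α) {u : ℝ} (hu : 0 ≤ u) :
    IntervalIntegrable (fun y => α y / jap y) volume 0 u :=
  (h.continuousOn_quot.mono (by rw [uIcc_of_le hu]; exact Icc_subset_Ici_self)).intervalIntegrable

lemma integral_quot_le (h : IsAdmissible C c η α) {u : ℝ} (hu : 0 ≤ u) :
    ∫ y in (0 : ℝ)..u, α y / jap y ≤ C := by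
  rw [intervalIntegral.integral_of_le hu]
  refine le_trans (setIntegral_mono_set h.integrable ?_ Ioc_subset_Ioi_self.eventuallyLE)
    h.integral_le
  filter_upwards [ae_restrict_mem measurableSet_Ioi] with y hy
  exact (h.quot_pos (le_of_lt hy)).le

lemma mul_quot_le_integral (h : IsAdmissible C c η α) {u : ℝ} (hu : 0 ≤ u) :
    u * (α u / jap u) ≤ ∫ y in (0 : ℝ)..u, α y / jap y := by
  have := intervalIntegral.integral_mono_on hu (intervalIntegrable_const (c := α u / jap u))
    (h.intervalIntegrable_quot hu) fun y hy => h.antitone hy.1 hu hy.2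
  simpa [mul_div_assoc] using this

lemma integral_le_mul (h : IsAdmissible C c η α) {u : ℝ} (hu : 0 ≤ u) :
    ∫ y in (0 : ℝ)..u, α y / jap y ≤ u * α 0 := by
  have := intervalIntegral.integral_mono_on hu (h.intervalIntegrable_quot hu)
    (intervalIntegrable_const (c := α 0 / jap 0))
    fun y hy => h.antitone self_mem_Ici hy.1 hy.1
  simpa [jap] using this

lemma eq_apply_zero (h : IsAdmissible C c η α) {y : ℝ} (hy : y ∈ Icc (0 : ℝ) 1) :
    α y = α 0 := by
  refine constant_of_has_deriv_right_zero
    (h.smooth.continuousOn.mono Icc_subset_Ici_self) (fun x hx => ?_) y hy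
  have hd := (h.smooth.differentiableOn (by simp) x hx.1).hasDerivWithinAt
  rw [h.deriv_eq_zero x ⟨hx.1, hx.2.le⟩] at hd
  exact hd.mono (Ici_subset_Ici.2 hx.1)

lemma apply_zero_le (h : IsAdmissible C c η α) (hC : 1 ≤ C) : α 0 ≤ 2 * C := by
  have h1 := (h.mul_quot_le_integral zero_le_one).trans (h.integral_quot_le zero_le_one)
  rw [h.eq_apply_zero ⟨zero_le_one, le_rfl⟩, one_mul, div_le_iff₀ (jap_pos 1)] at h1
  nlinarith [jap_sq 1, one_le_jap 1]

lemma div_le_quot (h : IsAdmissible C c η α) (hc : 0 < c) (hη : η ≤ 1) {y : ℝ} (hy : 0 ≤ y) :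
    c / (1 + y ^ 2) ≤ α y / jap y := by
  rw [le_div_iff₀ (jap_pos y)]
  refine le_trans ?_ (h.lower y hy)
  have h1 : jap y ^ (-1 : ℝ) ≤ jap y ^ (-η) :=
    Real.rpow_le_rpow_of_exponent_le (one_le_jap y) (by linarith)
  rw [Real.rpow_neg_one] at h1
  refine le_trans (le_of_eq ?_) (mul_le_mul_of_nonneg_left h1 hc.le)
  have := (jap_pos y).ne'
  rw [← jap_sq]
  field_simp

variable {δ s r : ℝ}

lemma betaHigh_le (h : IsAdmissible C c η α) (hδ : 0 < δ) (hr : 0 < r) :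
    betaHigh α δ s r ≤ Real.sqrt s * C :=
  mul_le_mul_of_nonneg_left (h.integral_quot_le (by positivity)) (Real.sqrt_nonneg s)

lemma betaHigh_le_mul (h : IsAdmissible C c η α) (hδ : 0 < δ) (hs : 0 < s) (hr : 0 < r) :
    betaHigh α δ s r ≤ δ * α 0 * r := by
  have hs' := Real.sqrt_pos.2 hs
  refine (mul_le_mul_of_nonneg_left (h.integral_le_mul (by positivity)) hs'.le).trans_eq ?_
  field_simp

lemma hasDerivAt_betaHigh (h : IsAdmissible C c η α) (hδ : 0 < δ) (hs : 0 < s) (hr : 0 < r) :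
    HasDerivAt (betaHigh α δ s)
      (δ * (α (δ * r / Real.sqrt s) / jap (δ * r / Real.sqrt s))) r := by
  have hs' := Real.sqrt_pos.2 hs
  have hu : 0 < δ * r / Real.sqrt s := by positivity
  have hG := intervalIntegral.integral_hasDerivAt_right (h.intervalIntegrable_quot hu.le)
    ((h.continuousOn_quot.mono Ioi_subset_Ici_self).stronglyMeasurableAtFilter isOpen_Ioi _ hu)
    (h.continuousOn_quot.continuousAt (Ici_mem_nhds hu))
  have hl : HasDerivAt (fun r : ℝ => δ * r / Real.sqrt s) (δ / Real.sqrt s) r := by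
    simpa using ((hasDerivAt_id r).const_mul δ).div_const (Real.sqrt s)
  refine ((hG.comp r hl).const_mul (Real.sqrt s)).congr_deriv ?_
  field_simp

lemma mul_deriv_le_betaHigh (h : IsAdmissible C c η α) (hδ : 0 < δ) (hs : 0 < s) (hr : 0 < r) :
    r * deriv (betaHigh α δ s) r ≤ betaHigh α δ s r := by
  have hs' := Real.sqrt_pos.2 hs
  rw [(h.hasDerivAt_betaHigh hδ hs hr).deriv]
  refine le_trans (le_of_eq ?_)
    (mul_le_mul_of_nonneg_left (h.mul_quot_le_integral (u := δ * r / Real.sqrt s)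
      (by positivity)) hs'.le)
  field_simp

lemma deriv_betaHigh_pos (h : IsAdmissible C c η α) (hδ : 0 < δ) (hs : 0 < s) (hr : 0 < r) :
    0 < deriv (betaHigh α δ s) r := by
  rw [(h.hasDerivAt_betaHigh hδ hs hr).deriv]
  exact mul_pos hδ (h.quot_pos (by positivity))

lemma div_le_deriv_betaHigh (h : IsAdmissible C c η α) (hc : 0 < c) (hη : η ≤ 1) (hδ : 0 < δ)
    (hs : 0 < s) (hr : 0 < r) :
    δ * c * s / (s + δ ^ 2 * r ^ 2) ≤ deriv (betaHigh α δ s) r := by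
  rw [(h.hasDerivAt_betaHigh hδ hs hr).deriv]
  refine le_trans (le_of_eq ?_) (mul_le_mul_of_nonneg_left
    (h.div_le_quot hc hη (y := δ * r / Real.sqrt s) (by positivity)) hδ.le)
  rw [div_pow, Real.sq_sqrt hs.le]
  field_simp

lemma deriv_betaHigh_of_le_one (h : IsAdmissible C c η α) (hδ : 0 < δ) (hs : 0 < s) (hr : 0 < r)
    (hy : δ * r / Real.sqrt s ≤ 1) :
    deriv (betaHigh α δ s) r = δ * α 0 / jap (δ * r / Real.sqrt s) := by
  rw [(h.hasDerivAt_betaHigh hδ hs hr).deriv, h.eq_apply_zero ⟨by positivity, hy⟩, ← mul_div_assoc]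

end IsAdmissible

lemma sinh_le_mul_cosh {r : ℝ} (hr : 0 ≤ r) : Real.sinh r ≤ r * Real.cosh r := by
  have hmono : MonotoneOn (fun x => x * Real.cosh x - Real.sinh x) (Ici 0) := by
    refine monotoneOn_of_hasDerivWithinAt_nonneg (f' := fun x => x * Real.sinh x) (convex_Ici 0)
      (by fun_prop) (fun x _ => ?_) fun x hx => ?_
    · refine HasDerivAt.hasDerivWithinAt ?_
      refine (((hasDerivAt_id x).mul (Real.hasDerivAt_cosh x)).sub
        (Real.hasDerivAt_sinh x)).congr_deriv ?_
      simp
    · rw [interior_Ici] at hx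
      exact mul_nonneg (le_of_lt hx) (Real.sinh_nonneg_iff.2 (le_of_lt hx))
  have := hmono self_mem_Ici hr hr
  simpa using this

lemma cosh_le_one_add_sq {r : ℝ} (hr0 : 0 ≤ r) (hr1 : r ≤ 1) : Real.cosh r ≤ 1 + r ^ 2 := by
  refine (Real.cosh_le_exp_half_sq r).trans ?_
  have h := (abs_le.1 (Real.abs_exp_sub_one_sub_id_le (x := r ^ 2 / 2)
    (by rw [abs_of_nonneg (by positivity)]; nlinarith))).2
  nlinarith [mul_nonneg (sq_nonneg r) (sub_nonneg.2 (show r ^ 2 ≤ 1 by nlinarith))]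

lemma cothR_le_two {r : ℝ} (hr : 1 ≤ r) : cothR r ≤ 2 := by
  have h0 : 0 < r := by linarith
  have h1 := Real.self_le_sinh_iff.2 h0.le
  rw [cothR, div_le_iff₀ (by linarith)]
  have h2 := Real.cosh_sub_sinh r
  have h3 : Real.exp (-r) ≤ 1 := Real.exp_le_one_iff.2 (by linarith)
  linarith

lemma sq_le_eight_mul_sinh {r : ℝ} (hr : 1 ≤ r) : r ^ 2 ≤ 8 * Real.sinh r := by
  have h0 : 0 < r := by linarith
  have h1 := Real.self_le_sinh_iff.2 h0.le
  have h2 := Real.cosh_sub_sinh r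
  have h3 : Real.exp (-r) ≤ 1 := Real.exp_le_one_iff.2 (by linarith)
  have h4 := Real.quadratic_le_exp_of_nonneg h0.le
  have h5 := Real.cosh_add_sinh r
  linarith

lemma IsAdmissible.angular_weight_nonneg {C c η δ s r : ℝ} {α : ℝ → ℝ}
    (h : IsAdmissible C c η α) (hδ : 0 < δ) (hs : 0 < s) (hr : 0 < r) :
    0 ≤ betaHigh α δ s r * cothR r - deriv (betaHigh α δ s) r := by
  have hsinh := Real.sinh_pos_iff.2 hr
  have h1 : 1 ≤ r * cothR r := by
    rw [cothR, ← mul_div_assoc, one_le_div hsinh]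
    exact sinh_le_mul_cosh hr.le
  have hcoth : 0 ≤ cothR r := div_nonneg (Real.cosh_pos r).le hsinh.le
  nlinarith [mul_le_mul_of_nonneg_right (h.mul_deriv_le_betaHigh hδ hs hr) hcoth,
    mul_le_mul_of_nonneg_left h1 (h.deriv_betaHigh_pos hδ hs hr).le]

/-- The region where both `r` and `δ s^{-1/2} r` are at most one. -/
lemma IsAdmissible.angular_weight_le_near {C c η δ s r : ℝ} {α : ℝ → ℝ}
    (h : IsAdmissible C c η α) (hC : 1 ≤ C) (hδ : 0 < δ) (hδ1 : δ ≤ 1) (hs : 0 < s)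
    (hr : 0 < r) (hr1 : r ≤ 1)
    (hy : δ * r / Real.sqrt s ≤ 1) :
    (betaHigh α δ s r * cothR r - deriv (betaHigh α δ s) r) / Real.sinh r ^ 2
      ≤ δ * s⁻¹ * deriv (betaHigh α δ s) r + 2 * C := by
  have hsinh := Real.sinh_pos_iff.2 hr
  have hrs := Real.self_le_sinh_iff.2 hr.le
  have ha : 0 < α 0 := h.pos 0 self_mem_Ici
  have haC := h.apply_zero_le hC
  set y := δ * r / Real.sqrt s with hydef
  have hy0 : 0 < y := by have := Real.sqrt_pos.2 hs; positivity
  have hysq : y ^ 2 = δ ^ 2 * s⁻¹ * r ^ 2 := by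
    rw [hydef, div_pow, Real.sq_sqrt hs.le]; field_simp
  have hd := h.deriv_betaHigh_of_le_one hδ hs hr hy
  have hj := jap_sq y
  have hj1 := one_le_jap y
  have hinv_lower : 1 - y ^ 2 / 2 ≤ 1 / jap y := by
    rw [le_div_iff₀ (jap_pos y)]
    nlinarith [mul_nonneg (sq_nonneg (jap y - 1)) (by linarith : 0 ≤ jap y + 2)]
  have hinv_half : 1 / 2 ≤ 1 / jap y :=
    one_div_le_one_div_of_le (jap_pos y) (by nlinarith)
  have hd' : deriv (betaHigh α δ s) r = δ * α 0 * (1 / jap y) := by rw [hd]; ring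
  have hcoth : 0 ≤ cothR r := div_nonneg (Real.cosh_pos r).le hsinh.le
  have hrcoth : r * cothR r ≤ 1 + r ^ 2 := by
    rw [cothR, ← mul_div_assoc, div_le_iff₀ hsinh]
    nlinarith [cosh_le_one_add_sq hr.le hr1,
      mul_le_mul_of_nonneg_left hrs (by positivity : 0 ≤ 1 + r ^ 2)]
  have hnum : betaHigh α δ s r * cothR r - deriv (betaHigh α δ s) r
      ≤ δ * α 0 * (1 + δ ^ 2 * s⁻¹ / 2) * r ^ 2 := by
    have h1 := mul_le_mul_of_nonneg_right (h.betaHigh_le_mul hδ hs hr) hcoth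
    have h2 := mul_le_mul_of_nonneg_left hrcoth (mul_pos hδ ha).le
    have h3 := mul_le_mul_of_nonneg_left hinv_lower (mul_pos hδ ha).le
    rw [hysq] at h3
    rw [hd']
    linarith
  have hs_inv : 0 < s⁻¹ := inv_pos.2 hs
  calc (betaHigh α δ s r * cothR r - deriv (betaHigh α δ s) r) / Real.sinh r ^ 2
      ≤ δ * α 0 * (1 + δ ^ 2 * s⁻¹ / 2) := by
        rw [div_le_iff₀ (by positivity)]
        exact hnum.trans (by gcongr)
    _ = δ * α 0 + δ * (δ ^ 2 * s⁻¹ * α 0 * (1 / 2)) := by ring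
    _ ≤ 1 * (2 * C) + 1 * (δ ^ 2 * s⁻¹ * α 0 * (1 / jap y)) := by
        gcongr
    _ = δ * s⁻¹ * deriv (betaHigh α δ s) r + 2 * C := by rw [hd']; ring

/-- The region `r ≤ 1 ≤ δ s^{-1/2} r`. -/
lemma IsAdmissible.angular_weight_le_mid {C c η δ s r : ℝ} {α : ℝ → ℝ}
    (h : IsAdmissible C c η α) (hC : 1 ≤ C) (hc : 0 < c) (hη : η ≤ 1) (hδ : 0 < δ)
    (hδ1 : 4 * C * δ ≤ c) (hs : 0 < s) (hr : 0 < r) (hr1 : r ≤ 1)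
    (hy : 1 ≤ δ * r / Real.sqrt s) :
    betaHigh α δ s r * cothR r / Real.sinh r ^ 2 ≤ δ * s⁻¹ * deriv (betaHigh α δ s) r := by
  have hsinh := Real.sinh_pos_iff.2 hr
  have hrs := Real.self_le_sinh_iff.2 hr.le
  have hs' := Real.sqrt_pos.2 hs
  rw [le_div_iff₀ hs', one_mul] at hy
  have hcosh : Real.cosh r ≤ 2 := by nlinarith [cosh_le_one_add_sq hr.le hr1]
  have hcoth : 0 ≤ cothR r := div_nonneg (Real.cosh_pos r).le hsinh.le
  have hsle : s ≤ δ ^ 2 * r ^ 2 := by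
    rw [← Real.sq_sqrt hs.le, ← mul_pow]; gcongr
  calc betaHigh α δ s r * cothR r / Real.sinh r ^ 2
      ≤ Real.sqrt s * C * cothR r / Real.sinh r ^ 2 := by
        gcongr; exact h.betaHigh_le hδ hr
    _ = Real.sqrt s * C * Real.cosh r / Real.sinh r ^ 3 := by
        rw [cothR]; field_simp
    _ ≤ δ * r * C * 2 / r ^ 3 := by gcongr
    _ = 4 * C * δ / (2 * r ^ 2) := by field_simp; ring
    _ ≤ c / (2 * r ^ 2) := by gcongr
    _ = δ * s⁻¹ * (δ * c * s / (δ ^ 2 * r ^ 2 + δ ^ 2 * r ^ 2)) := by field_simp; ring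
    _ ≤ δ * s⁻¹ * (δ * c * s / (s + δ ^ 2 * r ^ 2)) := by gcongr
    _ ≤ δ * s⁻¹ * deriv (betaHigh α δ s) r := by
        gcongr; exact h.div_le_deriv_betaHigh hc hη hδ hs hr

lemma IsAdmissible.angular_weight_le_of_one_le {C c η δ s s₂ r : ℝ} {α : ℝ → ℝ}
    (h : IsAdmissible C c η α) (hC : 1 ≤ C) (hδ : 0 < δ) (hs₂ : s ≤ s₂) (hr : 1 ≤ r) :
    betaHigh α δ s r * cothR r / Real.sinh r ^ 2 ≤ Real.sqrt s₂ * C * 128 / r ^ 4 := by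
  have hr0 : 0 < r := by linarith
  have hsinh := Real.sinh_pos_iff.2 hr0
  have hcoth : 0 ≤ cothR r := div_nonneg (Real.cosh_pos r).le hsinh.le
  calc betaHigh α δ s r * cothR r / Real.sinh r ^ 2
      ≤ Real.sqrt s₂ * C * 2 / (r ^ 2 / 8) ^ 2 := by
        gcongr
        · exact (h.betaHigh_le hδ hr0).trans (by gcongr)
        · exact cothR_le_two hr
        · linarith [sq_le_eight_mul_sinh hr]
    _ = Real.sqrt s₂ * C * 128 / r ^ 4 := by field_simp; ring

lemma IsAdmissible.angular_weight_le_far {C c η δ s s₂ r : ℝ} {α : ℝ → ℝ}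
    (h : IsAdmissible C c η α) (hC : 1 ≤ C) (hc : 0 < c) (hη : η ≤ 1) (hδ : 0 < δ)
    (hs : 0 < s) (hs₂ : s ≤ s₂) (hr : 1 ≤ r)
    (hR : Real.sqrt s₂ * C * 128 * (s₂ + δ ^ 2) / (δ ^ 2 * c) ≤ r) :
    betaHigh α δ s r * cothR r / Real.sinh r ^ 2 ≤ δ * s⁻¹ * deriv (betaHigh α δ s) r := by
  have hr0 : 0 < r := by linarith
  rw [div_le_iff₀ (by positivity)] at hR
  calc betaHigh α δ s r * cothR r / Real.sinh r ^ 2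
      ≤ Real.sqrt s₂ * C * 128 / r ^ 4 := h.angular_weight_le_of_one_le hC hδ hs₂ hr
    _ ≤ δ ^ 2 * c / ((s₂ + δ ^ 2) * r ^ 2) := by
        rw [div_le_div_iff₀ (by positivity) (by have := hs.trans_le hs₂; positivity)]
        calc _ = (Real.sqrt s₂ * C * 128 * (s₂ + δ ^ 2)) * r ^ 2 := by ring
          _ ≤ (r * (δ ^ 2 * c)) * r ^ 2 := by gcongr
          _ = δ ^ 2 * c * r ^ 3 := by ring
          _ ≤ δ ^ 2 * c * r ^ 4 := by gcongr; norm_num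
    _ ≤ δ ^ 2 * c / (s + δ ^ 2 * r ^ 2) := by
        gcongr
        nlinarith [mul_le_mul_of_nonneg_left (one_le_pow₀ hr : 1 ≤ r ^ 2) (hs.trans_le hs₂).le]
    _ = δ * s⁻¹ * (δ * c * s / (s + δ ^ 2 * r ^ 2)) := by field_simp
    _ ≤ δ * s⁻¹ * deriv (betaHigh α δ s) r := by
        gcongr; exact h.div_le_deriv_betaHigh hc hη hδ hs hr0

/-- **Upper bound for the angular weight of the high-frequency multiplier**
(Lemma 6.2, inequality (6.7)). -/
theorem high_freq_angular_weight_bound (C c η : ℝ) (hC : 1 ≤ C)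
    (hc0 : 0 < c) (hc1 : c ≤ 1) (hη0 : 0 < η) (hη1 : η < 1) :
    ∃ δ₀ > (0 : ℝ),
      ∀ δ : ℝ, 0 < δ → δ ≤ δ₀ →
      ∀ s₂ : ℝ, 0 < s₂ →
      ∃ C'' ≥ (1 : ℝ), ∃ R ≥ (1 : ℝ),
        ∀ α : ℝ → ℝ, IsAdmissible C c η α →
        ∀ s : ℝ, 0 < s → s ≤ s₂ →
        ∀ r > (0 : ℝ),
          0 ≤ (betaHigh α δ s r * cothR r - deriv (betaHigh α δ s) r) / Real.sinh r ^ 2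
          ∧ (betaHigh α δ s r * cothR r - deriv (betaHigh α δ s) r) / Real.sinh r ^ 2
              ≤ δ * s⁻¹ * deriv (betaHigh α δ s) r
                + C'' * Set.indicator (Set.Ioc (0 : ℝ) R) (fun _ => (1 : ℝ)) r := by
  refine ⟨c / (4 * C), by positivity, fun δ hδ hδ₀ s₂ hs₂ => ?_⟩
  have hδc : 4 * C * δ ≤ c := by
    rw [le_div_iff₀ (by positivity)] at hδ₀; linarith
  have hδ1 : δ ≤ 1 := by nlinarith
  refine ⟨2 * C + Real.sqrt s₂ * C * 128, by nlinarith [Real.sqrt_nonneg s₂],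
    max 1 (Real.sqrt s₂ * C * 128 * (s₂ + δ ^ 2) / (δ ^ 2 * c)), le_max_left _ _,
    fun α h s hs hss r hr => ⟨div_nonneg (h.angular_weight_nonneg hδ hs hr) (sq_nonneg _), ?_⟩⟩
  have hd := h.deriv_betaHigh_pos hδ hs hr
  have hd_scaled : 0 < δ * s⁻¹ * deriv (betaHigh α δ s) r := by positivity
  have hdrop : (betaHigh α δ s r * cothR r - deriv (betaHigh α δ s) r) / Real.sinh r ^ 2
      ≤ betaHigh α δ s r * cothR r / Real.sinh r ^ 2 := by
    gcongr; linarith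
  have hB : 0 ≤ Real.sqrt s₂ * C * 128 := by positivity
  by_cases hrR : r ≤ max 1 (Real.sqrt s₂ * C * 128 * (s₂ + δ ^ 2) / (δ ^ 2 * c))
  · rw [indicator_of_mem (show r ∈ Ioc 0 _ from ⟨hr, hrR⟩), mul_one]
    rcases le_total r 1 with hr1 | hr1
    · rcases le_total (δ * r / Real.sqrt s) 1 with hy | hy
      · linarith [h.angular_weight_le_near hC hδ hδ1 hs hr hr1 hy]
      · linarith [h.angular_weight_le_mid hC hc0 hη1.le hδ hδc hs hr hr1 hy]
    · have h1 := h.angular_weight_le_of_one_le hC hδ hss hr1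
      have h2 : Real.sqrt s₂ * C * 128 / r ^ 4 ≤ Real.sqrt s₂ * C * 128 :=
        div_le_self hB (one_le_pow₀ hr1)
      linarith
  · rw [indicator_of_notMem (fun hmem => hrR hmem.2), mul_zero, add_zero]
    obtain ⟨hr1, hr2⟩ := max_lt_iff.1 (not_le.1 hrR)
    exact hdrop.trans (h.angular_weight_le_far hC hc0 hη1.le hδ hs hss hr1.le hr2.le)
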